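/- arXiv:1609.06290 — 2 statements merged into one kernel-verified Lean document; each statement's English description precedes it below -/
import Mathlib

section
/- Let op_0 op_1 ... op_n be a valid sequence of order-2 stack operations and 0 ≤ j ≤ n. If op_j = ⇓ (collapse), then ℓ := push1(j−1) ≥ 0, and with k := Push2(ℓ − 1) one has push1(j) = push1(k − 1) and Push2(j) = Push2(k − 1). -/
/-- Order-2 stack operations over stack alphabet `S`. -/
inductive Op (S : Type) : Type where
  | push1 : S → Op S
  | pop1  : Op S
  | push2 : Op S
  | pop2  : Op S
  | collapse : Op S
  deriving DecidableEq

/-- Annotated stack symbol: (symbol, collapse link, position annotation). -/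
abbrev ASym (S : Type) : Type := S × ℕ × ℤ
/-- Annotated order-1 stack, topmost symbol first. -/
abbrev Stk1 (S : Type) : Type := List (ASym S)
/-- Annotated order-2 stack: list of (position annotation, order-1 stack), topmost first.
In `[[u_1][u_2] ⋯ [u_n]]` the topmost stack `u_n` comes first in the list. -/
abbrev Stk2 (S : Type) : Type := List (ℤ × Stk1 S)

/-- The initial order-2 stack `[[]]`, its unique (empty) order-1 stack annotated `-1`. -/
def initStk (S : Type) : Stk2 S := [(-1, ([] : Stk1 S))]

/-- One step of the annotated semantics; `p` is the current position.
`push1 s` records the collapse link `n-1` (number of stacks below the top) and the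
position annotation `p`; `push2` duplicates the top stack annotating the copy with `p`;
`collapse` keeps the bottom `i` order-1 stacks, where `i` is the collapse link of the
topmost symbol.  Undefined operations yield `none`. -/
def step {S : Type} (p : ℕ) (op : Op S) (W : Stk2 S) : Option (Stk2 S) :=
  match op, W with
  | .push2, t :: rest => some (((p : ℤ), t.2) :: t :: rest)
  | .pop2, _ :: t :: rest => some (t :: rest)
  | .push1 s, (a, u) :: rest => some ((a, (s, rest.length, (p : ℤ)) :: u) :: rest)
  | .pop1, (a, _ :: u) :: rest => some ((a, u) :: rest)
  | .collapse, (_, (_, i, _) :: _) :: _ =>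
      if 1 ≤ i ∧ i < W.length then some (W.drop (W.length - i)) else none
  | _, _ => none

def runFrom {S : Type} (p : ℕ) (W : Stk2 S) : List (Op S) → Option (Stk2 S)
  | [] => some W
  | op :: rest => (step p op W).bind fun W' => runFrom (p + 1) W' rest

/-- `stkAt ops j` is the annotated order-2 stack `W_j` after executing `op_0 ⋯ op_j`
(for `j = -1` this is the initial stack `[[]]`). -/
def stkAt {S : Type} (ops : List (Op S)) (j : ℤ) : Option (Stk2 S) :=
  runFrom 0 (initStk S) (ops.take (j + 1).toNat)

/-- A nonempty sequence of operations is valid if every operation is defined,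
starting from the empty order-2 stack `[[]]`. -/
def Valid {S : Type} (ops : List (Op S)) : Prop :=
  ops ≠ [] ∧ (runFrom 0 (initStk S) ops).isSome

/-- `push1At ops j` is `push1(j)`: the position annotation of the topmost symbol of the
topmost order-1 stack of `W_j`, or `-1` if that stack is empty (also `-1` for `j = -1`). -/
def push1At {S : Type} (ops : List (Op S)) (j : ℤ) : ℤ :=
  match stkAt ops j with
  | some ((_, (_, _, p) :: _) :: _) => p
  | _ => -1

/-- `Push2At ops j` is `Push2(j)`: the position annotation of the topmost order-1 stack
of `W_j` (`-1` for `j = -1`). -/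
def Push2At {S : Type} (ops : List (Op S)) (j : ℤ) : ℤ :=
  match stkAt ops j with
  | some ((a, _) :: _) => a
  | _ => -1

theorem runFrom_snoc {S : Type} (l : List (Op S)) (o : Op S) : ∀ (p : ℕ) (W : Stk2 S),
    runFrom p W (l ++ [o]) = (runFrom p W l).bind (step (p + l.length) o) := by
  induction l with
  | nil => intro p W; simp [runFrom]
  | cons x l ih =>
    intro p W
    simp only [List.cons_append, runFrom, List.length_cons]
    cases h : step p x W with
    | none => simp
    | some V =>
      simp only [Option.bind_some, ih]
      rw [show p + 1 + l.length = p + (l.length + 1) by omega]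

/-- Invariant of reachable annotated stacks relative to the run `R`. -/
def GoodStk {S : Type} (R : ℕ → Option (Stk2 S)) : Stk2 S → Prop
  | [] => True
  | t :: rest => ((rest = [] ∧ t.1 = -1) ∨ ∃ p : ℕ, t.1 = p ∧ R p = some rest) ∧
      (∀ x ∈ t.2, ∃ (q : ℕ) (b : ℤ × Stk1 S) (r : Stk2 S), x.2.2 = q ∧ R q = some (b :: r) ∧
        r.length = x.2.1 ∧ r <:+ rest) ∧ GoodStk R rest

theorem GoodStk.drop {S : Type} {R : ℕ → Option (Stk2 S)} : ∀ (W : Stk2 S) (n : ℕ),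
    GoodStk R W → GoodStk R (W.drop n)
  | [], n, _ => by simp [GoodStk]
  | t :: W, 0, h => by simpa using h
  | t :: W, n + 1, h => by simpa using GoodStk.drop W n h.2.2

theorem GoodStk.step {S : Type} {R : ℕ → Option (Stk2 S)} {p : ℕ} {o : Op S} {W V : Stk2 S}
    (hW : GoodStk R W) (hR : R p = some W) (h : step p o W = some V) : GoodStk R V := by
  unfold _root_.step at h
  split at h
  · cases h
    refine ⟨Or.inr ⟨p, rfl, hR⟩, ?_, hW⟩
    intro x hx
    obtain ⟨q, b, r, h1, h2, h3, h4⟩ := hW.2.1 x hx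
    exact ⟨q, b, r, h1, h2, h3, h4.trans (List.suffix_cons _ _)⟩
  · cases h
    exact hW.2.2
  · cases h
    refine ⟨hW.1, ?_, hW.2.2⟩
    intro x hx
    rcases List.mem_cons.1 hx with rfl | hx
    · exact ⟨p, _, _, rfl, hR, rfl, List.suffix_refl _⟩
    · exact hW.2.1 x hx
  · cases h
    exact ⟨hW.1, fun x hx => hW.2.1 x (List.mem_cons_of_mem _ hx), hW.2.2⟩
  · split at h
    · cases h
      exact GoodStk.drop _ _ hW
    · cases h
  · cases h

theorem take_succ_run {S : Type} (ops : List (Op S)) (m : ℕ) (o : Op S)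
    (h : ops[m]? = some o) :
    runFrom 0 (initStk S) (ops.take (m + 1)) =
      (runFrom 0 (initStk S) (ops.take m)).bind (step m o) := by
  obtain ⟨hm, -⟩ := List.getElem?_eq_some_iff.1 h
  rw [List.take_add_one, h, Option.toList_some, runFrom_snoc]
  simp [Nat.min_eq_left hm.le]

theorem goodStk_run {S : Type} (ops : List (Op S)) : ∀ (m : ℕ) (W : Stk2 S),
    runFrom 0 (initStk S) (ops.take m) = some W →
    GoodStk (fun m => runFrom 0 (initStk S) (ops.take m)) W := by
  intro m
  induction m with
  | zero =>
    intro W h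
    simp only [List.take_zero, runFrom, Option.some.injEq] at h
    subst h
    simp [initStk, GoodStk]
  | succ m ih =>
    intro W h
    cases ho : ops[m]? with
    | none =>
      rw [List.take_add_one, ho] at h
      exact ih W (by simpa using h)
    | some o =>
      rw [take_succ_run ops m o ho] at h
      obtain ⟨V, hV, hs⟩ := Option.bind_eq_some_iff.1 h
      exact GoodStk.step (ih V hV) hV hs

theorem run_take_some {S : Type} (l : List (Op S)) : ∀ (p : ℕ) (W : Stk2 S) (m : ℕ),
    (runFrom p W l).isSome → (runFrom p W (l.take m)).isSome := by
  induction l with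
  | nil => intro p W m h; simpa using h
  | cons x l ih =>
    intro p W m h
    cases m with
    | zero => simp [runFrom]
    | succ m =>
      simp only [List.take_succ_cons, runFrom] at h ⊢
      cases hs : step p x W with
      | none => simp [hs] at h
      | some V =>
        simp only [hs, Option.bind_some] at h ⊢
        exact ih _ _ _ h

/-- In a valid sequence, if `op_j = ⇓` then `ℓ := push1(j-1) ≥ 0` and,
with `k := Push2(ℓ - 1)`, `push1(j) = push1(k - 1)` and `Push2(j) = Push2(k - 1)`. -/
theorem collapse_step_push1_Push2 {S : Type} (ops : List (Op S)) (hv : Valid ops)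
    (j : ℕ) (hj : j < ops.length) (hop : ops[j]? = some Op.collapse) :
    0 ≤ push1At ops ((j : ℤ) - 1) ∧
    push1At ops (j : ℤ) = push1At ops (Push2At ops (push1At ops ((j : ℤ) - 1) - 1) - 1) ∧
    Push2At ops (j : ℤ) = Push2At ops (Push2At ops (push1At ops ((j : ℤ) - 1) - 1) - 1) := by
  obtain ⟨V, hV⟩ := Option.isSome_iff_exists.1 (run_take_some ops 0 (initStk S) (j + 1) hv.2)
  have hV' := hV
  rw [take_succ_run ops j _ hop] at hV'
  obtain ⟨W, hW, hs⟩ := Option.bind_eq_some_iff.1 hV'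
  have hg := goodStk_run ops j W hW
  have hat : ∀ m : ℕ, stkAt ops ((m : ℤ) - 1) = runFrom 0 (initStk S) (ops.take m) := by
    intro m
    simp [stkAt]
  have hat' : stkAt ops (j : ℤ) = some V := by
    rw [← hV, ← hat (j + 1)]
    congr 1
    push_cast
    ring
  unfold step at hs
  split at hs
  any_goals (rename_i heq; cases heq; done)
  · rename_i c s i q u rest _
    split at hs
    case isFalse => cases hs
    rename_i hi
    obtain ⟨hi1, hi2⟩ := hi
    obtain ⟨q', b, r, h1, h2, h3, h4⟩ := hg.2.1 (s, i, q) (by simp)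
    dsimp only at h1 h2 h3
    have hVr : V = r := by
      cases hs
      have h5 : r <:+ (c, (s, i, q) :: u) :: rest := h4.trans (List.suffix_cons _ _)
      subst h3
      exact (List.suffix_iff_eq_drop.1 h5).symm
    subst hVr
    have hp1 : push1At ops ((j : ℤ) - 1) = (q' : ℤ) := by
      simp [push1At, hat, hW, h1]
    have hp2 : Push2At ops ((q' : ℤ) - 1) = b.1 := by
      simp [Push2At, hat, h2]
    have hg2 := goodStk_run ops q' _ h2
    rcases hg2.1 with ⟨h6, -⟩ | ⟨k, hk, hRk⟩
    · rw [h6] at h3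
      simp at h3
      omega
    · rw [hp1, hp2, hk]
      have : stkAt ops ((k : ℤ) - 1) = stkAt ops (j : ℤ) := by
        rw [hat, hat']
        exact hRk
      refine ⟨by omega, ?_, ?_⟩
      · simp only [push1At, this]
      · simp only [Push2At, this]
  · cases hs
end

section
/- Existence of covering pop: Let N = ⟨w, ↷1, ↷2⟩ be a collapse-free 2-NW whose first two positions 0 and 1 both execute order-1 pushes ↑1, with ↷1-pops of position 0 being y¹_1 < ... < y¹_m and ↷1-pops of position 1 being y²_1 < ... < y²_n. Then for every i ∈ {1,...,m} there exists j ∈ {1,...,n} such that y²_j < y¹_i and either y²_j is top-level or ctxt-pop(y¹_i) ≤ ctxt-pop(y²_j). -/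
/-- The order-1 nesting relation `i ↷1 j` of the 2-NW generated by `ops`. -/
def Nest1 {S : Type} (ops : List (Op S)) (i j : ℕ) : Prop :=
  ops[j]? = some Op.pop1 ∧ (i : ℤ) = push1At ops ((j : ℤ) - 1)

/-- The order-2 nesting relation `i ↷2 j` of the 2-NW generated by `ops`:
either `j` is a `↓2` popping the order-1 stack created at `i`, or `j` is a collapse
and `i ≥ 0` is the position annotation of one of the order-1 stacks removed by it
(the removed stacks are the topmost `|W_{j-1}| - |W_j|` ones). -/
def Nest2 {S : Type} (ops : List (Op S)) (i j : ℕ) : Prop :=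
  (ops[j]? = some Op.pop2 ∧ (i : ℤ) = Push2At ops ((j : ℤ) - 1)) ∨
  (ops[j]? = some Op.collapse ∧
    ∃ W W' : Stk2 S, stkAt ops ((j : ℤ) - 1) = some W ∧ stkAt ops (j : ℤ) = some W' ∧
      ∃ d : ℕ, d < W.length - W'.length ∧ ∃ e, W[d]? = some e ∧ e.1 = (i : ℤ))

/-- `x` is top-level: no `↷2` edge strictly encloses `x`. -/
def TopLevel {S : Type} (ops : List (Op S)) (x : ℕ) : Prop :=
  ¬ ∃ z y, Nest2 ops z y ∧ z < x ∧ x < y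

/-- `CtxtPop ops x y`: `y` is the context-pop of `x`, i.e. the order-2 pop of the
innermost `↷2` edge enclosing `x`. -/
def CtxtPop {S : Type} (ops : List (Op S)) (x y : ℕ) : Prop :=
  ∃ z, Nest2 ops z y ∧ z < x ∧ x < y ∧
    ¬ ∃ z' y', Nest2 ops z' y' ∧ z < z' ∧ z' < x ∧ x < y' ∧ y' < y

def StN {S : Type} (ops : List (Op S)) (n : ℕ) : Stk2 S :=
  (runFrom 0 (initStk S) (ops.take n)).getD []

/-- Annotations of the order-1 stacks after `n` operations. -/
def An {S : Type} (ops : List (Op S)) (n : ℕ) : List ℤ := (StN ops n).map Prod.fst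

theorem runFrom_append {S : Type} (l₁ l₂ : List (Op S)) (p : ℕ) (W : Stk2 S) :
    runFrom p W (l₁ ++ l₂) = (runFrom p W l₁).bind fun W' => runFrom (p + l₁.length) W' l₂ := by
  induction l₁ generalizing p W with
  | nil => simp [runFrom]
  | cons op l ih =>
    simp only [List.cons_append, runFrom, List.length_cons]
    cases step p op W with
    | none => simp
    | some W' => simp [ih, Nat.add_assoc, Nat.add_comm 1]

theorem run_some {S : Type} {ops : List (Op S)} (hv : Valid ops) (n : ℕ) :
    runFrom 0 (initStk S) (ops.take n) = some (StN ops n) := by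
  have h := hv.2
  rw [← List.take_append_drop n ops, runFrom_append] at h
  unfold StN
  cases hr : runFrom 0 (initStk S) (ops.take n) with
  | none => rw [hr] at h; simp at h
  | some W => simp

theorem step_some {S : Type} {ops : List (Op S)} (hv : Valid ops) {n : ℕ} {op : Op S}
    (h : ops[n]? = some op) : step n op (StN ops n) = some (StN ops (n + 1)) := by
  have h1 := run_some hv (n + 1)
  obtain ⟨hn, _⟩ := List.getElem?_eq_some_iff.1 h
  rw [List.take_add_one, h, runFrom_append, run_some hv n] at h1
  have hm : min n ops.length = n := by omega
  simp [runFrom, hm] at h1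
  exact h1

theorem stkAt_eq {S : Type} {ops : List (Op S)} (hv : Valid ops) (j : ℕ) :
    stkAt ops ((j : ℤ) - 1) = some (StN ops j) := by
  unfold stkAt
  simpa using run_some hv j

theorem An_step {S : Type} {ops : List (Op S)} (hv : Valid ops) (hcf : Op.collapse ∉ ops)
    {n : ℕ} (hn : n < ops.length) :
    (An ops (n + 1) = An ops n ∧ ops[n]? ≠ some Op.pop2) ∨
    (An ops (n + 1) = (n : ℤ) :: An ops n ∧ An ops n ≠ [] ∧ ops[n]? ≠ some Op.pop2) ∨
    (ops[n]? = some Op.pop2 ∧ ∃ a b r, An ops n = a :: b :: r ∧ An ops (n + 1) = b :: r) := by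
  have h : ops[n]? = some ops[n] := List.getElem?_eq_getElem hn
  have hs := step_some hv h
  have hc : ops[n] ≠ Op.collapse := fun hh => hcf (hh ▸ List.getElem_mem hn)
  rw [h]
  unfold An
  generalize ops[n] = op at *
  generalize StN ops n = W at *
  generalize StN ops (n + 1) = W' at *
  unfold step at hs
  split at hs <;> simp at hs hc <;> subst hs <;> simp

theorem An_zero {S : Type} (ops : List (Op S)) : An ops 0 = [-1] := by
  simp [An, StN, runFrom, initStk]

theorem An_inv {S : Type} {ops : List (Op S)} (hv : Valid ops) (hcf : Op.collapse ∉ ops)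
    (n : ℕ) (hn : n ≤ ops.length) :
    ∀ a b r, (a :: b :: r) <:+ An ops n → 0 ≤ a ∧ a < n := by
  induction n with
  | zero =>
    intro a b r h
    rw [An_zero] at h
    have := h.length_le
    simp at this
  | succ n ih =>
    intro a b r h
    have ih := ih (by omega)
    rcases An_step hv hcf (n := n) (by omega) with ⟨h1, _⟩ | ⟨h1, _⟩ | ⟨_, x, y, t, h1, h2⟩
    · rw [h1] at h
      have := ih a b r h
      push_cast; omega
    · rw [h1, List.suffix_cons_iff] at h
      rcases h with h | h
      · simp at h; push_cast; omega
      · have := ih a b r h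
        push_cast; omega
    · rw [h2] at h
      have := ih a b r (by rw [h1]; exact h.trans (List.suffix_cons _ _))
      push_cast; omega

/-- A suffix headed by the stack created at `z` is present since the creation. -/
theorem suffix_back {S : Type} {ops : List (Op S)} (hv : Valid ops) (hcf : Op.collapse ∉ ops)
    {z : ℕ} {R : List ℤ} {m : ℕ} (hm : m ≤ ops.length) (h : ((z : ℤ) :: R) <:+ An ops m)
    {k : ℕ} (hzk : z < k) (hkm : k ≤ m) : ((z : ℤ) :: R) <:+ An ops k := by
  induction m, hkm using Nat.le_induction with
  | base => exact h
  | succ m hkm ih =>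
    apply ih (by omega)
    rcases An_step hv hcf (n := m) (by omega) with ⟨h1, _⟩ | ⟨h1, _⟩ | ⟨_, x, y, t, h1, h2⟩
    · rwa [h1] at h
    · rw [h1, List.suffix_cons_iff] at h
      rcases h with h | h
      · simp at h; omega
      · exact h
    · rw [h1, ← h2]; exact h.trans (List.suffix_cons _ _)

theorem nest2_iff {S : Type} {ops : List (Op S)} (hv : Valid ops) (hcf : Op.collapse ∉ ops)
    {i j : ℕ} : Nest2 ops i j ↔ ops[j]? = some Op.pop2 ∧ ∃ R, An ops j = (i : ℤ) :: R := by
  unfold Nest2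
  have hc : ops[j]? ≠ some Op.collapse := fun h => hcf (List.mem_of_getElem? h)
  simp only [hc, false_and, or_false, Push2At, stkAt_eq hv, An]
  apply and_congr_right
  intro hp
  have := step_some hv hp
  generalize StN ops j = W at *
  rcases W with _ | ⟨⟨a, u⟩, r⟩
  · simp [step] at this
  · simp [eq_comm]

theorem nest2_pop {S : Type} {ops : List (Op S)} (hv : Valid ops) (hcf : Op.collapse ∉ ops)
    {j : ℕ} (h : ops[j]? = some Op.pop2) :
    ∃ a b r, An ops j = a :: b :: r ∧ An ops (j + 1) = b :: r := by
  obtain ⟨hn, _⟩ := List.getElem?_eq_some_iff.1 h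
  rcases An_step hv hcf hn with ⟨_, h1⟩ | ⟨_, _, h1⟩ | ⟨_, h1⟩
  · exact absurd h h1
  · exact absurd h h1
  · exact h1

theorem topLevel_of {S : Type} {ops : List (Op S)} (hv : Valid ops) (hcf : Op.collapse ∉ ops)
    {x : ℕ} (h : ∀ m, x ≤ m → m ≤ ops.length → An ops x <:+ An ops m) : TopLevel ops x := by
  rintro ⟨z, y, hn, hzx, hxy⟩
  obtain ⟨hp, R, hR⟩ := (nest2_iff hv hcf).1 hn
  obtain ⟨hy, _⟩ := List.getElem?_eq_some_iff.1 hp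
  obtain ⟨a, b, r, h1, h2⟩ := nest2_pop hv hcf hp
  have h3 : ((z : ℤ) :: R) <:+ An ops x :=
    suffix_back hv hcf hy.le (by rw [hR]) hzx hxy.le
  have h4 := h3.length_le
  have h5 := (h (y + 1) (by omega) (by omega)).length_le
  rw [← hR, h1] at h4
  rw [h2] at h5
  simp at h4 h5
  omega

theorem ctxt_of {S : Type} {ops : List (Op S)} (hv : Valid ops) (hcf : Op.collapse ∉ ops)
    {x : ℕ} (hx : ops[x]? = some Op.pop1) {m : ℕ} (hxm : x ≤ m) (hm : m ≤ ops.length)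
    (h : ¬ An ops x <:+ An ops m) :
    ∃ c, c < m ∧ CtxtPop ops x c ∧ ¬ An ops x <:+ An ops (c + 1) := by
  classical
  have hex : ∃ m, x ≤ m ∧ m ≤ ops.length ∧ ¬ An ops x <:+ An ops m := ⟨m, hxm, hm, h⟩
  obtain ⟨k1, k2, k3⟩ := Nat.find_spec hex
  have kmin := fun j => Nat.find_min hex (m := j)
  have kle := Nat.find_min' hex ⟨hxm, hm, h⟩
  generalize Nat.find hex = k at *
  have hkx : x ≠ k := by
    rintro rfl
    exact k3 (List.suffix_refl _)
  obtain ⟨c, rfl⟩ : ∃ c, k = c + 1 := ⟨k - 1, by omega⟩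
  have hsuf : ∀ j, x ≤ j → j ≤ c → An ops x <:+ An ops j := by
    intro j h1 h2
    by_contra h3
    exact kmin j (by omega) ⟨h1, by omega, h3⟩
  have hc := hsuf c (by omega) le_rfl
  refine ⟨c, by omega, ?_, k3⟩
  rcases An_step hv hcf (n := c) (by omega) with ⟨h1, _⟩ | ⟨h1, _⟩ | ⟨hp, a, b, r, h1, h2⟩
  · rw [h1] at k3; exact absurd hc k3
  · rw [h1] at k3; exact absurd (hc.trans (List.suffix_cons _ _)) k3
  · have hAx : An ops x = a :: b :: r := by
      rw [h1, List.suffix_cons_iff] at hc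
      rcases hc with hc | hc
      · exact hc
      · rw [h2] at k3; exact absurd hc k3
    obtain ⟨ha0, hax⟩ := An_inv hv hcf x (by omega) a b r (by rw [hAx])
    obtain ⟨z, rfl⟩ := Int.eq_ofNat_of_zero_le ha0
    have hxc : x ≠ c := by
      rintro rfl
      rw [hx] at hp; simp at hp
    refine ⟨z, (nest2_iff hv hcf).2 ⟨hp, _, h1⟩, by omega, by omega, ?_⟩
    rintro ⟨z', y', hn, hz, hzx, hxy, hy⟩
    obtain ⟨_, R, hR⟩ := (nest2_iff hv hcf).1 hn
    have h3 : ((z' : ℤ) :: R) <:+ An ops x :=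
      suffix_back hv hcf (m := y') (by omega) (by rw [hR]) hzx hxy.le
    have h4 := hsuf y' (by omega) (by omega)
    rw [hR] at h4
    have h5 := h3.eq_of_length_le h4.length_le
    rw [hAx] at h5
    simp at h5
    omega

/-- Position annotations of an order-1 stack. -/
def posn {S : Type} (u : Stk1 S) : List ℤ := u.map fun x => x.2.2

/-- Symbols 1 and 0 are still at the bottom. -/
def Good {S : Type} (u : Stk1 S) : Prop := ∃ v, posn u = v ++ [1, 0] ∧ (0 : ℤ) ∉ v

/-- Symbol 1 has been popped in a stack that is still there. -/
def Popped {S : Type} (ops : List (Op S)) (n : ℕ) (B : List ℤ) : Prop :=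
  ∃ y, y < n ∧ Nest1 ops 1 y ∧ (∀ m, y ≤ m → m ≤ n → An ops y <:+ An ops m) ∧ An ops y <:+ B

theorem Popped.mono {S : Type} {ops : List (Op S)} {n : ℕ} {B B' : List ℤ}
    (h : Popped ops n B) (hB : B <:+ B') (hB' : B <:+ An ops (n + 1)) : Popped ops (n + 1) B' := by
  obtain ⟨y, h1, h2, h3, h4⟩ := h
  refine ⟨y, by omega, h2, ?_, h4.trans hB⟩
  intro m hm hm'
  rcases Nat.lt_or_ge n m with h | h
  · obtain rfl : m = n + 1 := by omega
    exact h4.trans hB'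
  · exact h3 m hm h

theorem main_inv {S : Type} {ops : List (Op S)} (hv : Valid ops) (hcf : Op.collapse ∉ ops)
    {s₀ s₁ : S} (h₀ : ops[0]? = some (Op.push1 s₀)) (h₁ : ops[1]? = some (Op.push1 s₁))
    (n : ℕ) (hn2 : 2 ≤ n) (hn : n ≤ ops.length) :
    ∀ a u R, ((a, u) :: R) <:+ StN ops n → Good u ∨ Popped ops n (a :: R.map Prod.fst) := by
  induction n, hn2 using Nat.le_induction with
  | base =>
    intro a u R h
    have e0 : StN ops 0 = initStk S := by simp [StN, runFrom]
    have e1 := step_some hv h₀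
    have e2 := step_some hv h₁
    rw [e0] at e1
    simp [step, initStk] at e1
    rw [← e1] at e2
    simp [step] at e2
    rw [← e2] at h
    rw [List.suffix_cons_iff] at h
    simp at h
    left
    refine ⟨[], ?_, by simp⟩
    rw [h.1.2]; simp [posn]
  | succ n hn2 ih =>
    replace ih := ih (by omega)
    intro a u R h
    have ho : ops[n]? = some ops[n] := List.getElem?_eq_getElem (by omega)
    have hs := step_some hv ho
    have hc : ops[n] ≠ Op.collapse := fun hh => hcf (hh ▸ List.getElem_mem _)
    have hN : ∀ t, ops[n] = Op.pop1 → ∀ b v r, StN ops n = (b, t :: v) :: r → t.2.2 = 1 →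
        Nest1 ops 1 n := by
      intro t h1 b v r h2 h3
      refine ⟨by rw [ho, h1], ?_⟩
      rw [push1At, stkAt_eq hv, h2]
      simp [h3]
    have hA : An ops (n + 1) = (StN ops (n + 1)).map Prod.fst := rfl
    have hA0 : An ops n = (StN ops n).map Prod.fst := rfl
    have hsufA : (a :: R.map Prod.fst) <:+ An ops (n + 1) := by
      rw [hA]; exact h.map Prod.fst
    -- entries inherited unchanged
    have keep : ((a, u) :: R) <:+ StN ops n →
        Good u ∨ Popped ops (n + 1) (a :: R.map Prod.fst) := by
      intro h
      rcases ih a u R h with h' | h'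
      · exact Or.inl h'
      · exact Or.inr (h'.mono (List.suffix_refl _) hsufA)
    generalize ops[n] = op at *
    generalize StN ops n = W at *
    generalize StN ops (n + 1) = W' at *
    unfold step at hs
    split at hs <;> simp at hs hc <;> subst hs
    · -- push2
      rename_i t rest
      obtain ⟨b, v⟩ := t
      rw [List.suffix_cons_iff] at h
      rcases h with h | h
      · simp at h
        obtain ⟨⟨h1, h2⟩, h3⟩ := h
        subst u
        subst a
        subst R
        rcases ih b v rest (List.suffix_refl _) with h' | h'
        · exact Or.inl h'
        · right
          apply h'.mono
          · simp
          · rw [hA]; simp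
      · exact keep h
    · exact keep (h.trans (List.suffix_cons _ _))
    · -- push1
      rename_i s b v rest
      rw [List.suffix_cons_iff] at h
      rcases h with h | h
      · simp at h
        obtain ⟨⟨h1, h2⟩, h3⟩ := h
        subst u
        subst a
        subst R
        rcases ih b v rest (List.suffix_refl _) with ⟨w, h', hw⟩ | h'
        · left
          refine ⟨(n : ℤ) :: w, by simpa [posn] using h', ?_⟩
          simp [hw]; omega
        · exact Or.inr (h'.mono (List.suffix_refl _) hsufA)
      · exact keep (h.trans (List.suffix_cons _ _))
    · -- pop1
      rename_i b t v rest
      rw [List.suffix_cons_iff] at h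
      rcases h with h | h
      · simp at h
        obtain ⟨⟨h1, h2⟩, h3⟩ := h
        subst u
        subst a
        subst R
        rcases ih b (t :: v) rest (List.suffix_refl _) with ⟨w, h', hw⟩ | h'
        · rcases w with _ | ⟨x, w⟩
          · right
            simp [posn] at h'
            refine ⟨n, by omega, hN t rfl b v rest rfl h'.1, ?_, by rw [hA0]; simp⟩
            intro m h1 h2
            rcases Nat.lt_or_ge n m with h | h
            · obtain rfl : m = n + 1 := by omega
              rw [hA, hA0]; simp
            · obtain rfl : m = n := by omega
              exact List.suffix_refl _
          · left
            simp [posn] at h'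
            simp at hw
            exact ⟨w, by simpa [posn] using h'.2, hw.2⟩
        · exact Or.inr (h'.mono (List.suffix_refl _) hsufA)
      · exact keep (h.trans (List.suffix_cons _ _))

/-- **existence of covering pop.** Let `N` be a collapse-free 2-NW whose
first two positions `0` and `1` both execute order-1 pushes.  Then for every `↷1`-pop
`y₁` of position `0` there is a `↷1`-pop `y₂` of position `1` with `y₂ < y₁` such that
either `y₂` is top-level or `ctxt-pop(y₁) ≤ ctxt-pop(y₂)`. -/
theorem covering_pop_exists {S : Type} (ops : List (Op S)) (hv : Valid ops)
    (hcf : Op.collapse ∉ ops)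
    (s₀ s₁ : S) (h₀ : ops[0]? = some (Op.push1 s₀)) (h₁ : ops[1]? = some (Op.push1 s₁)) :
    ∀ y₁, Nest1 ops 0 y₁ →
      ∃ y₂, Nest1 ops 1 y₂ ∧ y₂ < y₁ ∧
        (TopLevel ops y₂ ∨
          ∃ c₁ c₂, CtxtPop ops y₁ c₁ ∧ CtxtPop ops y₂ c₂ ∧ c₁ ≤ c₂) := by
  intro y₁ hy
  obtain ⟨hp, hpush⟩ := hy
  obtain ⟨hlt, _⟩ := List.getElem?_eq_some_iff.1 hp
  have hy2 : 2 ≤ y₁ := by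
    rcases y₁ with _ | _ | y
    · rw [h₀] at hp; simp at hp
    · rw [h₁] at hp; simp at hp
    · omega
  have hinv := main_inv hv hcf h₀ h₁ y₁ hy2 hlt.le
  rw [push1At, stkAt_eq hv] at hpush
  have hs := step_some hv hp
  have hA : An ops y₁ = (StN ops y₁).map Prod.fst := rfl
  have key : Popped ops y₁ (An ops y₁) := by
    generalize StN ops y₁ = W at *
    rcases W with _ | ⟨⟨a, _ | ⟨⟨s, l, p⟩, u⟩⟩, R⟩
    · simp [step] at hs
    · simp [step] at hs
    · simp at hpush
      rcases hinv a _ R (List.suffix_refl _) with ⟨w, h', hw⟩ | h'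
      · exfalso
        rcases w with _ | ⟨x, w⟩
        · simp [posn] at h'; omega
        · simp [posn] at h'
          simp at hw
          omega
      · rw [hA]; exact h'
  obtain ⟨y₂, hlt2, hn1, hsuf, hsuf1⟩ := key
  refine ⟨y₂, hn1, hlt2, ?_⟩
  by_cases hall : ∀ m, y₂ ≤ m → m ≤ ops.length → An ops y₂ <:+ An ops m
  · exact Or.inl (topLevel_of hv hcf hall)
  · right
    push Not at hall
    obtain ⟨m, hm1, hm2, hm3⟩ := hall
    obtain ⟨c₂, hc2, hctx2, hnot⟩ := ctxt_of hv hcf hn1.1 hm1 hm2 hm3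
    have hlow : y₁ < c₂ + 1 := by
      by_contra hcon
      obtain ⟨z, _, _, hlt3, _⟩ := hctx2
      exact hnot (hsuf (c₂ + 1) (by omega) (by omega))
    obtain ⟨c₁, hc1, hctx1, _⟩ := ctxt_of hv hcf hp (m := c₂ + 1) (by omega) (by omega)
      (fun h => hnot (hsuf1.trans h))
    exact ⟨c₁, c₂, hctx1, hctx2, by omega⟩
end
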